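/- arXiv:1405.5188 — 2 statements merged into one kernel-verified Lean document; each statement's English description precedes it below -/
import Mathlib

section
/- Let (R, m) be a commutative Noetherian local ring and N a nonzero finitely generated Tor-rigid R-module. Then depth(N) ≤ depth(R). -/
open CategoryTheory

noncomputable section

variable (R : Type) [CommRing R]

/-- `Ext^n_R(M,N)` as an `R`-module object. -/
abbrev ext (n : ℕ) (M N : ModuleCat R) : ModuleCat R :=
  ((Ext R (ModuleCat R) n).obj (Opposite.op M)).obj N

/-- `Tor_n^R(M,N)`. -/
abbrev tor (n : ℕ) (M N : ModuleCat R) : ModuleCat R :=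
  ((Tor (ModuleCat R) n).obj M).obj N

/-- projective dimension, via vanishing of `Ext` in degrees above `n`. -/
def projDim (M : ModuleCat R) : ℕ∞ :=
  sInf {n : ℕ∞ | ∀ (i : ℕ) (X : ModuleCat R), n < i → Subsingleton (ext R i M X)}

/-- injective dimension, via vanishing of `Ext` in degrees above `n`. -/
def injDim (N : ModuleCat R) : ℕ∞ :=
  sInf {n : ℕ∞ | ∀ (i : ℕ) (X : ModuleCat R), n < i → Subsingleton (ext R i X N)}

/-- depth over a local ring, as the least `n` with `Ext^n(k, N) ≠ 0`. -/
def depth [IsLocalRing R] (N : ModuleCat R) : ℕ∞ :=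
  sInf {n : ℕ∞ | ∃ i : ℕ, n = i ∧
    ¬ Subsingleton (ext R i (ModuleCat.of R (IsLocalRing.ResidueField R)) N)}

/-- Tor-rigidity. -/
def TorRigid (N : ModuleCat R) : Prop :=
  ∀ (X : ModuleCat R), Module.Finite R X → ∀ n : ℕ, 1 ≤ n →
    Subsingleton (tor R n N X) → Subsingleton (tor R (n + 1) N X)

/-- test module for projectivity. -/
def TestModule (M : ModuleCat R) : Prop :=
  ∀ (X : ModuleCat R), Module.Finite R X → projDim R X = ⊤ →
    {j : ℕ | ¬ Subsingleton (tor R j M X)}.Infinite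

/-- strongly-rigid module. -/
def StronglyRigid (N : ModuleCat R) : Prop :=
  ∀ (X : ModuleCat R), Module.Finite R X → ∀ n : ℕ, 1 ≤ n →
    Subsingleton (tor R n N X) → projDim R X < ⊤

/-- rigid-test module. -/
def RigidTest (N : ModuleCat R) : Prop :=
  ∀ (X : ModuleCat R), Module.Finite R X → ∀ n : ℕ, 1 ≤ n →
    Subsingleton (tor R n N X) →
      Subsingleton (tor R (n + 1) N X) ∧ projDim R X < ⊤


lemma exists_cover [IsNoetherianRing R] (M : ModuleCat.{0} R) :
    ∃ (C : ModuleCat.{0} R) (p : C ⟶ M), Function.Surjective p.hom ∧ Module.Free R C ∧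
      (Module.Finite R M → Module.Finite R C) := by
  by_cases h : Module.Finite R M
  · obtain ⟨n, f, hf⟩ := Module.Finite.exists_fin' R M
    exact ⟨ModuleCat.of R (Fin n → R), ModuleCat.ofHom f, hf, inferInstanceAs (Module.Free R (Fin n → R)),
      fun _ => inferInstanceAs (Module.Finite R (Fin n → R))⟩
  · refine ⟨ModuleCat.of R (M →₀ R), ModuleCat.ofHom (Finsupp.linearCombination R id),
      ?_, inferInstanceAs (Module.Free R (M →₀ R)), fun h' => absurd h' h⟩
    exact Finsupp.linearCombination_id_surjective R M

lemma exists_succ [IsNoetherianRing R] {A B : ModuleCat.{0} R} (f : B ⟶ A) :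
    ∃ (C : ModuleCat.{0} R) (d : C ⟶ B), Function.Exact d.hom f.hom ∧ Module.Free R C ∧
      (Module.Finite R B → Module.Finite R C) := by
  obtain ⟨C, p, hp, hC, hfin⟩ := exists_cover R (ModuleCat.of R (LinearMap.ker f.hom))
  refine ⟨C, ModuleCat.ofHom ((LinearMap.ker f.hom).subtype ∘ₗ p.hom), ?_, hC, fun _ => hfin ?_⟩
  · rw [LinearMap.exact_iff]
    change _ = LinearMap.range ((LinearMap.ker f.hom).subtype ∘ₗ p.hom)
    rw [LinearMap.range_comp, LinearMap.range_eq_top.2 hp]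
    simp
  · exact inferInstanceAs (Module.Finite R (LinearMap.ker f.hom))

def succC [IsNoetherianRing R] {A B : ModuleCat.{0} R} (f : B ⟶ A) : ModuleCat.{0} R :=
  (exists_succ R f).choose
def succD [IsNoetherianRing R] {A B : ModuleCat.{0} R} (f : B ⟶ A) : succC R f ⟶ B :=
  (exists_succ R f).choose_spec.choose

lemma succ_spec [IsNoetherianRing R] {A B : ModuleCat.{0} R} (f : B ⟶ A) :
    Function.Exact (succD R f).hom f.hom ∧ Module.Free R (succC R f) ∧
      (Module.Finite R B → Module.Finite R (succC R f)) :=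
  (exists_succ R f).choose_spec.choose_spec

lemma succ_zero [IsNoetherianRing R] {A B : ModuleCat.{0} R} (f : B ⟶ A) :
    succD R f ≫ f = 0 := by
  ext x
  exact (succ_spec R f).1.apply_apply_eq_zero x

def resC [IsNoetherianRing R] {A B : ModuleCat.{0} R} (f : B ⟶ A) :
    ChainComplex (ModuleCat.{0} R) ℕ :=
  ChainComplex.mk' A B f (fun g => ⟨succC R g, succD R g, succ_zero R g⟩)

lemma resC_iso [IsNoetherianRing R] {A B : ModuleCat.{0} R} (f : B ⟶ A) (n : ℕ) :
    ∃ e : (resC R f).X (n + 2) ≅ succC R ((resC R f).d (n + 1) n),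
      (resC R f).d (n + 2) (n + 1) = e.hom ≫ succD R ((resC R f).d (n + 1) n) :=
  ⟨ChainComplex.mk'XIso A B f (fun g => ⟨succC R g, succD R g, succ_zero R g⟩) n,
    ChainComplex.mk'_d A B f (fun g => ⟨succC R g, succD R g, succ_zero R g⟩) n⟩

lemma resC_prop [IsNoetherianRing R] {A B : ModuleCat.{0} R} (f : B ⟶ A)
    (hA : Module.Free R A) (hA' : Module.Finite R A)
    (hB : Module.Free R B) (hB' : Module.Finite R B) (n : ℕ) :
    (Module.Free R ((resC R f).X n) ∧ Module.Finite R ((resC R f).X n)) ∧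
    (Module.Free R ((resC R f).X (n+1)) ∧ Module.Finite R ((resC R f).X (n+1))) := by
  induction n with
  | zero => exact ⟨⟨hA, hA'⟩, ⟨hB, hB'⟩⟩
  | succ n ih =>
    refine ⟨ih.2, ?_⟩
    obtain ⟨e, -⟩ := resC_iso R f n
    have h := succ_spec R ((resC R f).d (n+1) n)
    have h1 := h.2.1
    have h2 := h.2.2 ih.2.2
    exact ⟨Module.Free.of_equiv e.toLinearEquiv.symm, Module.Finite.equiv e.toLinearEquiv.symm⟩

lemma resC_exact' [IsNoetherianRing R] {A B : ModuleCat.{0} R} (f : B ⟶ A) (n : ℕ) :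
    Function.Exact ((resC R f).d (n + 2) (n + 1)).hom ((resC R f).d (n + 1) n).hom := by
  obtain ⟨e, he⟩ := resC_iso R f n
  have h := (succ_spec R ((resC R f).d (n+1) n)).1
  intro x
  refine (h x).trans ⟨?_, ?_⟩
  · rintro ⟨y, rfl⟩
    refine ⟨e.inv.hom y, ?_⟩
    rw [he, ← LinearMap.comp_apply, ← ModuleCat.hom_comp, Iso.inv_hom_id_assoc]
  · rintro ⟨y, rfl⟩
    rw [he]
    exact ⟨e.hom.hom y, rfl⟩

lemma exists_complex [IsNoetherianRing R] {A B : ModuleCat.{0} R} (f : B ⟶ A)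
    (hA : Module.Free R A) (hA' : Module.Finite R A)
    (hB : Module.Free R B) (hB' : Module.Finite R B) :
    ∃ (K : ChainComplex (ModuleCat.{0} R) ℕ) (e0 : K.X 0 ≅ A) (e1 : K.X 1 ≅ B),
      (∀ n, Module.Free R (K.X n) ∧ Module.Finite R (K.X n)) ∧
      (∀ n, Function.Exact (K.d (n + 2) (n + 1)).hom (K.d (n + 1) n).hom) ∧
      K.d 1 0 ≫ e0.hom = e1.hom ≫ f := by
  refine ⟨resC R f, Iso.refl _, Iso.refl _, fun n => (resC_prop R f hA hA' hB hB' n).1,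
    resC_exact' R f, ?_⟩
  have hd : (resC R f).d 1 0 = f := ChainComplex.mk'_d_1_0 _ _ _ _
  exact (Category.comp_id _).trans (hd.trans (Category.id_comp _).symm)

lemma exists_res {X : ModuleCat.{0} R} (K : ChainComplex (ModuleCat.{0} R) ℕ) (p : K.X 0 ⟶ X)
    (hK : ∀ n, Module.Free R (K.X n))
    (hKe : ∀ n, Function.Exact (K.d (n + 2) (n + 1)).hom (K.d (n + 1) n).hom)
    (hex : Function.Exact (K.d 1 0).hom p.hom) (hp : Function.Surjective p.hom) :
    ∃ Q : ProjectiveResolution X, Q.complex = K := by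
  have hw : K.d 1 0 ≫ p = 0 := by
    ext x; exact hex.apply_apply_eq_zero x
  have hpe : Epi p := (ModuleCat.epi_iff_surjective p).2 hp
  have hE : (ShortComplex.mk (K.d 1 0) p hw).Exact := by
    rw [ShortComplex.moduleCat_exact_iff]
    intro x hx
    exact (hex x).1 hx
  refine ⟨{ complex := K
            projective := fun n => ?_
            π := (ChainComplex.toSingle₀Equiv _ _).symm ⟨p, hw⟩
            quasiIso := ⟨fun n => ?_⟩ }, rfl⟩
  · have := hK n
    exact (K.X n).projective_of_categoryTheory_projective
  · cases n
    · rw [ChainComplex.quasiIsoAt₀_iff, ShortComplex.quasiIso_iff_of_zeros']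
      · refine (ShortComplex.exact_and_epi_g_iff_of_iso ?_).2 ⟨hE, hpe⟩
        refine ShortComplex.isoMk (Iso.refl _) (Iso.refl _) (Iso.refl _) ?_ ?_
        · exact (Category.id_comp _).trans (Category.comp_id _).symm
        · refine (Category.id_comp _).trans (Eq.trans ?_ (Category.comp_id _).symm)
          exact (ChainComplex.toSingle₀Equiv_symm_apply_f_zero p hw).symm
      all_goals first | rfl | exact K.shape _ _ (by simp)
    · rename_i n
      rw [quasiIsoAt_iff_exactAt']
      · rw [HomologicalComplex.exactAt_iff' _ (n + 1 + 1) (n + 1) n (by simp) (by simp)]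
        rw [ShortComplex.moduleCat_exact_iff]
        intro x hx
        exact (hKe n x).1 hx
      · apply ChainComplex.exactAt_succ_single_obj

lemma tor_exact {X : ModuleCat.{0} R} (N : ModuleCat.{0} R) (Q : ProjectiveResolution X)
    (K : ChainComplex (ModuleCat.{0} R) ℕ) (hQ : Q.complex = K) (n : ℕ) :
    Subsingleton (tor R (n + 1) N X) ↔
      Function.Exact ((K.d (n + 2) (n + 1)).hom.lTensor N)
        ((K.d (n + 1) n).hom.lTensor N) := by
  subst hQ
  rw [← ModuleCat.isZero_iff_subsingleton]
  let e := Q.isoLeftDerivedObj ((MonoidalCategory.tensoringLeft (ModuleCat R)).obj N) (n + 1)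
  refine (Iso.isZero_iff e).trans ?_
  change Limits.IsZero (HomologicalComplex.homology _ _) ↔ _
  rw [← HomologicalComplex.exactAt_iff_isZero_homology,
    HomologicalComplex.exactAt_iff' _ (n + 1 + 1) (n + 1) n (by simp) (by simp),
    ShortComplex.moduleCat_exact_iff_range_eq_ker, LinearMap.exact_iff]
  exact eq_comm

lemma ext_exact {M : ModuleCat.{0} R} (N : ModuleCat.{0} R) (Q : ProjectiveResolution M) (n : ℕ) :
    Subsingleton (ext R n M N) ↔
      Function.Exact ((Q.complex.d n ((ComplexShape.up ℕ).prev n)).hom.lcomp R N)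
        ((Q.complex.d ((ComplexShape.up ℕ).next n) n).hom.lcomp R N) := by
  rw [← ModuleCat.isZero_iff_subsingleton, Iso.isZero_iff (Q.isoExt n N)]
  rw [← HomologicalComplex.exactAt_iff_isZero_homology,
    HomologicalComplex.exactAt_iff, ShortComplex.moduleCat_exact_iff]
  constructor
  · intro h x
    constructor
    · intro hx
      obtain ⟨y, hy⟩ := h (ModuleCat.ofHom x) (ModuleCat.hom_ext hx)
      exact ⟨ModuleCat.Hom.hom y, congrArg ModuleCat.Hom.hom hy⟩
    · rintro ⟨y, rfl⟩
      ext z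
      change y ((Q.complex.d _ _ ≫ Q.complex.d _ _).hom z) = 0
      rw [Q.complex.d_comp_d]
      exact map_zero y
  · intro h x hx
    obtain ⟨y, hy⟩ := (h (ModuleCat.Hom.hom x)).1 (congrArg ModuleCat.Hom.hom hx)
    exact ⟨ModuleCat.ofHom y, ModuleCat.hom_ext hy⟩
section core
open TensorProduct

lemma subsingleton_of_tensor [IsLocalRing R] (N Q : Type) [AddCommGroup N] [Module R N]
    [AddCommGroup Q] [Module R Q] [Module.Finite R N] [Module.Finite R Q] [Nontrivial N]
    (h : Subsingleton (N ⊗[R] Q)) : Subsingleton Q := by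
  let k := IsLocalRing.ResidueField R
  have h1 : Nontrivial (k ⊗[R] N) := by
    by_contra hc
    rw [not_nontrivial_iff_subsingleton, IsLocalRing.subsingleton_tensorProduct] at hc
    exact not_subsingleton N hc
  have h2 : Subsingleton ((k ⊗[R] N) ⊗[R] Q) :=
    (TensorProduct.assoc R k N Q).toEquiv.subsingleton_congr.2 inferInstance
  obtain ⟨v, hv⟩ := exists_ne (0 : k ⊗[R] N)
  obtain ⟨φ, hφ⟩ := Module.Projective.exists_dual_ne_zero k hv
  have hs : Function.Surjective (φ.restrictScalars R) := LinearMap.surjective (by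
    rintro rfl; exact hφ rfl)
  have h3 := LinearMap.rTensor_surjective Q hs
  rw [← IsLocalRing.subsingleton_tensorProduct (R := R)]
  exact h3.subsingleton

lemma core [IsNoetherianRing R] [IsLocalRing R] (N : ModuleCat.{0} R) [Module.Finite R N]
    (hN : Nontrivial N) (hrig : TorRigid R N) {A B : ModuleCat.{0} R} (f : B ⟶ A)
    (hA : Module.Free R A) (hA' : Module.Finite R A)
    (hB : Module.Free R B) (hB' : Module.Finite R B)
    {C : Type} [AddCommGroup C] [Module R C] (g : C →ₗ[R] B) (hfg : f.hom ∘ₗ g = 0)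
    (hex : Function.Exact (g.lTensor N) (f.hom.lTensor N)) : Function.Exact g f.hom := by
  obtain ⟨K, e0, e1, hK, hKe, hc⟩ := exists_complex R f hA hA' hB hB'
  let d := (K.d 1 0).hom
  let g' : C →ₗ[R] K.X 1 := e1.inv.hom ∘ₗ g
  have hd : d = e0.inv.hom ∘ₗ f.hom ∘ₗ e1.hom.hom := by
    have : K.d 1 0 = e1.hom ≫ f ≫ e0.inv := by
      rw [← Category.assoc, ← hc, Category.assoc, Iso.hom_inv_id, Category.comp_id]
    change (K.d 1 0).hom = _
    rw [this]; rfl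
  have hee : e1.hom.hom ∘ₗ e1.inv.hom = LinearMap.id := by
    rw [← ModuleCat.hom_comp, Iso.inv_hom_id]; rfl
  have hee' : e1.inv.hom ∘ₗ e1.hom.hom = LinearMap.id := by
    rw [← ModuleCat.hom_comp, Iso.hom_inv_id]; rfl
  have hee0 : e0.hom.hom ∘ₗ e0.inv.hom = LinearMap.id := by
    rw [← ModuleCat.hom_comp, Iso.inv_hom_id]; rfl
  have hf : f.hom = e0.hom.hom ∘ₗ d ∘ₗ e1.inv.hom := by
    ext x
    rw [hd]
    have h1 := LinearMap.congr_fun hee x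
    have h2 := LinearMap.congr_fun hee0 (f.hom x)
    simp only [LinearMap.comp_apply, LinearMap.id_apply] at h1 h2 ⊢
    rw [h1, h2]
  have hdg : d ∘ₗ g' = 0 := by
    ext x
    have h1 := LinearMap.congr_fun hee (g x)
    have h2 := LinearMap.congr_fun hfg x
    simp only [LinearMap.comp_apply, LinearMap.id_apply, LinearMap.zero_apply] at h1 h2
    simp [hd, g', h1, h2]
  have hex' : ∀ z : N ⊗[R] K.X 1, d.lTensor N z = 0 → ∃ u, g'.lTensor N u = z := by
    intro z hz
    have : f.hom.lTensor N (e1.hom.hom.lTensor N z) = 0 := by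
      rw [← LinearMap.comp_apply, ← LinearMap.lTensor_comp]
      have h3 : f.hom ∘ₗ e1.hom.hom = e0.hom.hom ∘ₗ d := by
        rw [hf, LinearMap.comp_assoc, LinearMap.comp_assoc, hee', LinearMap.comp_id]
      rw [h3, LinearMap.lTensor_comp, LinearMap.comp_apply, hz, map_zero]
    obtain ⟨u, hu⟩ := (hex _).1 this
    refine ⟨u, ?_⟩
    rw [LinearMap.lTensor_comp, LinearMap.comp_apply, hu, ← LinearMap.comp_apply,
      ← LinearMap.lTensor_comp, hee', LinearMap.lTensor_id]; rfl
  have hfin : ∀ n, Module.Finite R (K.X n) := fun n => (hK n).2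
  let X : ModuleCat.{0} R := ModuleCat.of R (K.X 0 ⧸ LinearMap.range d)
  obtain ⟨Q, hQ⟩ := exists_res R (X := X) K (ModuleCat.ofHom (LinearMap.range d).mkQ)
    (fun n => (hK n).1) hKe (LinearMap.exact_map_mkQ_range d) (Submodule.mkQ_surjective _)
  have hdd : d ∘ₗ (K.d 2 1).hom = 0 := by
    ext x; exact (hKe 0).apply_apply_eq_zero x
  let Z := LinearMap.ker d
  have hker : ∀ (S : Type) [AddCommGroup S] [Module R S] (q : S →ₗ[R] K.X 1)
      (h : d ∘ₗ q = 0), ∀ x, q x ∈ Z := fun S _ _ q h x => LinearMap.congr_fun h x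
  let h : K.X 2 →ₗ[R] Z := (K.d 2 1).hom.codRestrict Z (hker _ _ hdd)
  let c : C →ₗ[R] Z := g'.codRestrict Z (hker _ _ hdg)
  have hh : Z.subtype ∘ₗ h = (K.d 2 1).hom := rfl
  have hcc : Z.subtype ∘ₗ c = g' := rfl
  have hsurj : Function.Surjective h := by
    rintro ⟨x, hx⟩
    obtain ⟨y, hy⟩ := (hKe 0 x).1 hx
    exact ⟨y, Subtype.ext hy⟩
  have hhk : h ∘ₗ (K.d 3 2).hom = 0 := by
    ext x
    exact (hKe 1).apply_apply_eq_zero x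
  have hT1 : Subsingleton (tor R 1 N X) := by
    rw [tor_exact R N Q K hQ 0]
    intro z
    constructor
    · intro hz
      obtain ⟨u, rfl⟩ := hex' z hz
      obtain ⟨w, hw⟩ := LinearMap.lTensor_surjective N hsurj (c.lTensor N u)
      refine ⟨w, ?_⟩
      change (K.d 2 1).hom.lTensor N w = _
      rw [← hh, ← hcc, LinearMap.lTensor_comp, LinearMap.lTensor_comp, LinearMap.comp_apply, hw]
      rfl
    · rintro ⟨w, rfl⟩
      change d.lTensor N ((K.d 2 1).hom.lTensor N w) = 0
      rw [← LinearMap.comp_apply, ← LinearMap.lTensor_comp, hdd, LinearMap.lTensor_zero]; rfl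
  have hXfin : Module.Finite R X :=
    inferInstanceAs (Module.Finite R (K.X 0 ⧸ LinearMap.range d))
  have hT2 := hrig X hXfin 1 le_rfl hT1
  rw [tor_exact R N Q K hQ 1] at hT2
  have hinj : ∀ z : N ⊗[R] Z, Z.subtype.lTensor N z = 0 → z = 0 := by
    intro z hz
    obtain ⟨w, rfl⟩ := LinearMap.lTensor_surjective N hsurj z
    rw [← LinearMap.comp_apply, ← LinearMap.lTensor_comp, hh] at hz
    obtain ⟨v, rfl⟩ := (hT2 w).1 hz
    change h.lTensor N ((K.d 3 2).hom.lTensor N v) = 0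
    rw [← LinearMap.comp_apply, ← LinearMap.lTensor_comp, hhk, LinearMap.lTensor_zero]; rfl
  have hcs : Function.Surjective (c.lTensor N) := by
    intro z
    obtain ⟨u, hu⟩ := hex' (Z.subtype.lTensor N z) (by
      rw [← LinearMap.comp_apply, ← LinearMap.lTensor_comp]
      have : d ∘ₗ Z.subtype = 0 := by ext x; exact x.2
      rw [this, LinearMap.lTensor_zero]; rfl)
    refine ⟨u, sub_eq_zero.1 (hinj _ ?_)⟩
    rw [map_sub, ← hu, ← LinearMap.comp_apply, ← LinearMap.lTensor_comp, hcc, sub_self]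
  have hsub : Subsingleton (N ⊗[R] (Z ⧸ LinearMap.range c)) := by
    rw [subsingleton_iff_forall_eq 0]
    intro z
    obtain ⟨y, rfl⟩ := LinearMap.lTensor_surjective N (LinearMap.range c).mkQ_surjective z
    obtain ⟨u, rfl⟩ := hcs y
    rw [← LinearMap.comp_apply, ← LinearMap.lTensor_comp, LinearMap.range_mkQ_comp,
      LinearMap.lTensor_zero]; rfl
  have hq := subsingleton_of_tensor R N _ hsub
  rw [Submodule.Quotient.subsingleton_iff] at hq
  intro x
  constructor
  · intro hx
    have hz : e1.inv.hom x ∈ Z := by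
      change d (e1.inv.hom x) = 0
      have h1 := LinearMap.congr_fun hee x
      simp only [LinearMap.comp_apply, LinearMap.id_apply] at h1
      simp [hd, h1, hx]
    obtain ⟨y, hy⟩ := LinearMap.range_eq_top.1 hq ⟨_, hz⟩
    refine ⟨y, ?_⟩
    have h2 : e1.inv.hom (g y) = e1.inv.hom x := congrArg Subtype.val hy
    have h3 := LinearMap.congr_fun hee x
    have h4 := LinearMap.congr_fun hee (g y)
    simp only [LinearMap.comp_apply, LinearMap.id_apply] at h3 h4
    rw [← h3, ← h4, h2]
  · rintro ⟨y, rfl⟩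
    exact LinearMap.congr_fun hfg y
end core
section final
open TensorProduct

lemma dual_exact {A B C : Type} [AddCommGroup A] [Module R A] [AddCommGroup B] [Module R B]
    [AddCommGroup C] [Module R C] [Module.Free R A] [Module.Finite R A]
    [Module.Free R B] [Module.Finite R B] [Module.Free R C] [Module.Finite R C]
    (N : Type) [AddCommGroup N] [Module R N] (a : A →ₗ[R] B) (b : B →ₗ[R] C)
    (h : Function.Exact (b.lcomp R N) (a.lcomp R N)) :
    Function.Exact ((b.lcomp R R : Module.Dual R C →ₗ[R] Module.Dual R B).lTensor N)
      ((a.lcomp R R : Module.Dual R B →ₗ[R] Module.Dual R A).lTensor N) := by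
  let e (P : Type) [AddCommGroup P] [Module R P] [Module.Free R P] [Module.Finite R P] :
      N ⊗[R] Module.Dual R P ≃ₗ[R] (P →ₗ[R] N) :=
    (TensorProduct.comm R N (Module.Dual R P)).trans (dualTensorHomEquiv R P N)
  have nat : ∀ (P P' : Type) [AddCommGroup P] [Module R P] [Module.Free R P] [Module.Finite R P]
      [AddCommGroup P'] [Module R P'] [Module.Free R P'] [Module.Finite R P'] (q : P →ₗ[R] P'),
      (q.lcomp R N) ∘ₗ (e P').toLinearMap = (e P).toLinearMap ∘ₗ
        ((q.lcomp R R : Module.Dual R P' →ₗ[R] Module.Dual R P).lTensor N) := by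
    intro P P' _ _ _ _ _ _ _ _ q
    ext n φ x
    simp [e]
  exact (Function.Exact.iff_of_ladder_linearEquiv (nat _ _ b) (nat _ _ a)).1 h

lemma ext_rigid [IsNoetherianRing R] [IsLocalRing R] (M N : ModuleCat.{0} R) [Module.Finite R M]
    [Module.Finite R N] (hN : Nontrivial N) (hrig : TorRigid R N) (n : ℕ)
    (h : Subsingleton (ext R n M N)) : Subsingleton (ext R n M (ModuleCat.of R R)) := by
  obtain ⟨P0, p, hp, hP0, hP0'⟩ := exists_cover R M
  have hP0' := hP0' inferInstance
  obtain ⟨P1, d, hd, hP1, hP1'⟩ := exists_succ R p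
  have hP1' := hP1' hP0'
  obtain ⟨K, e0, e1, hK, hKe, hc⟩ := exists_complex R d hP0 hP0' hP1 hP1'
  have hsurj : Function.Surjective e0.hom.hom := e0.toLinearEquiv.surjective
  obtain ⟨Q, hQ⟩ := exists_res R K (e0.hom ≫ p) (fun n => (hK n).1) hKe (by
    have h1 : Function.Exact (d.hom ∘ₗ e1.toLinearEquiv.toLinearMap) p.hom := by
      intro x
      rw [hd x]
      exact (e1.toLinearEquiv.surjective.range_comp d.hom).symm ▸ Iff.rfl
    intro x
    refine (h1 (e0.hom.hom x)).trans ⟨?_, ?_⟩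
    · rintro ⟨y, hy⟩
      refine ⟨y, e0.toLinearEquiv.injective ?_⟩
      have := congrArg (fun q => q.hom y) hc
      exact this.trans hy
    · rintro ⟨y, rfl⟩
      have := congrArg (fun q => q.hom y) hc
      exact ⟨y, this.symm⟩) (hp.comp hsurj)
  subst hQ
  rw [ext_exact R _ Q] at h ⊢
  have hfr : ∀ n, Module.Free R (Q.complex.X n) := fun n => (hK n).1
  have hfi : ∀ n, Module.Finite R (Q.complex.X n) := fun n => (hK n).2
  have h2 := dual_exact R N _ _ h
  refine core R N hN hrig (A := ModuleCat.of R (Module.Dual R _))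
    (B := ModuleCat.of R (Module.Dual R _)) (ModuleCat.ofHom (LinearMap.lcomp R R _)) ?_ ?_ ?_ ?_
    (LinearMap.lcomp R R _) ?_ h2
  · exact inferInstanceAs (Module.Free R (Module.Dual R _))
  · exact inferInstanceAs (Module.Finite R (Module.Dual R _))
  · exact inferInstanceAs (Module.Free R (Module.Dual R _))
  · exact inferInstanceAs (Module.Finite R (Module.Dual R _))
  · ext y z
    change y ((Q.complex.d _ _ ≫ Q.complex.d _ _).hom z) = 0
    rw [Q.complex.d_comp_d]
    exact map_zero y
end final
/-- a nonzero f.g. Tor-rigid module satisfies `depth N ≤ depth R`. -/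
theorem stmt3 [IsNoetherianRing R] [IsLocalRing R]
    (N : ModuleCat R) [Module.Finite R N] (hN : Nontrivial N)
    (hrig : TorRigid R N) :
    depth R N ≤ depth R (ModuleCat.of R R) := by
  apply le_sInf
  rintro _ ⟨i, rfl, hi⟩
  apply sInf_le
  refine ⟨i, rfl, fun h => hi ?_⟩
  have : Module.Finite R (ModuleCat.of R (IsLocalRing.ResidueField R)) :=
    Module.Finite.of_surjective (Algebra.linearMap R (IsLocalRing.ResidueField R))
      Ideal.Quotient.mk_surjective
  exact ext_rigid R _ N hN hrig i h
end
end

section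
/- Let (R, m) be a commutative Noetherian local ring, M and N nonzero finitely generated R-modules. Assume N is Tor-rigid and Ext^n_R(M,N) = 0 for some nonnegative integer n. Then Ext^n_R(M,R) = 0. -/
open CategoryTheory

noncomputable section

variable (R : Type) [CommRing R]

section Aux

open TensorProduct

variable {R}

lemma aux_nak [IsLocalRing R] (N Q : Type) [AddCommGroup N] [Module R N] [AddCommGroup Q]
    [Module R Q] [Module.Finite R N] [Nontrivial N] [Module.Finite R Q]
    (h : Subsingleton (N ⊗[R] Q)) : Subsingleton Q := by
  obtain ⟨I, f, hI, hf⟩ := Module.exists_surjective_quotient_of_finite R N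
  rw [← IsLocalRing.subsingleton_tensorProduct (R := R)]
  have hle := IsLocalRing.le_maximalIdeal hI
  let g : (R ⧸ I) →ₗ[R] IsLocalRing.ResidueField R := (Ideal.Quotient.factorₐ R hle).toLinearMap
  have hg : Function.Surjective g := Ideal.Quotient.factor_surjective hle
  exact (LinearMap.rTensor_surjective Q (g := g ∘ₗ f) (hg.comp hf)).subsingleton

lemma aux_core [IsLocalRing R] {N A B C P0 P1 P2 P3 : Type}
    [AddCommGroup N] [Module R N] [Module.Finite R N] [Nontrivial N]
    [AddCommGroup A] [Module R A] [Module.Finite R A] [Module.Projective R A]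
    [AddCommGroup B] [Module R B] [Module.Finite R B] [Module.Projective R B]
    [AddCommGroup C] [Module R C] [Module.Finite R C] [Module.Projective R C]
    [AddCommGroup P0] [Module R P0] [AddCommGroup P1] [Module R P1]
    [AddCommGroup P2] [Module R P2] [Module.Finite R P2] [AddCommGroup P3] [Module R P3]
    (u : A →ₗ[R] B) (v : B →ₗ[R] C) (huv : v ∘ₗ u = 0)
    (d1 : P1 →ₗ[R] P0) (d2 : P2 →ₗ[R] P1) (d3 : P3 →ₗ[R] P2)
    (e0 : P0 ≃ₗ[R] Module.Dual R A) (e1 : P1 ≃ₗ[R] Module.Dual R B)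
    (he : ∀ x, e0 (d1 x) = u.dualMap (e1 x))
    (h12 : Function.Exact d2 d1) (h23 : d2 ∘ₗ d3 = 0)
    (hN : ∀ φ : B →ₗ[R] N, φ ∘ₗ u = 0 → ∃ ψ : C →ₗ[R] N, ψ ∘ₗ v = φ)
    (hrig : (∀ x, d1.lTensor N x = 0 → ∃ y, d2.lTensor N y = x) →
      (∀ x, d2.lTensor N x = 0 → ∃ y, d3.lTensor N y = x)) :
    ∀ φ : B →ₗ[R] R, φ ∘ₗ u = 0 → ∃ ψ : C →ₗ[R] R, ψ ∘ₗ v = φ := by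
  -- lift of the dual of `v`
  have hlift : ∃ w : Module.Dual R C →ₗ[R] P2, d2 ∘ₗ w = e1.symm.toLinearMap ∘ₗ v.dualMap := by
    have hmem : ∀ c, (e1.symm.toLinearMap ∘ₗ v.dualMap) c ∈ LinearMap.ker d1 := by
      intro c
      rw [LinearMap.mem_ker]
      apply e0.injective
      rw [he, map_zero]
      ext a
      have := LinearMap.congr_fun huv a
      simp only [LinearMap.comp_apply, LinearMap.zero_apply] at this
      simp [LinearMap.dualMap_apply, this]
    have hr : ∀ c, d2 c ∈ LinearMap.ker d1 := fun c => h12.apply_apply_eq_zero c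
    obtain ⟨w, hw⟩ := Module.projective_lifting_property
      (d2.codRestrict (LinearMap.ker d1) hr)
      ((e1.symm.toLinearMap ∘ₗ v.dualMap).codRestrict (LinearMap.ker d1) hmem) (by
        rintro ⟨x, hx⟩
        obtain ⟨y, hy⟩ := (h12 x).1 hx
        exact ⟨y, Subtype.ext hy⟩)
    refine ⟨w, ?_⟩
    ext1 c
    exact congrArg Subtype.val (LinearMap.congr_fun hw c)
  obtain ⟨w, hw⟩ := hlift
  -- the identification of `N ⊗ B*` with `Hom(B,N)`
  have key : ∀ x : N ⊗[R] P1, d1.lTensor N x = 0 →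
      ∃ y : N ⊗[R] Module.Dual R C, (d2 ∘ₗ w).lTensor N y = x := by
    intro x hx
    let xB : Module.Dual R B ⊗[R] N := TensorProduct.comm R _ _ (e1.toLinearMap.lTensor N x)
    have hxx : u.dualMap.rTensor N xB = 0 := by
      have h1 : u.dualMap.rTensor N xB =
          TensorProduct.comm R _ _ (e0.toLinearMap.lTensor N (d1.lTensor N x)) := by
        simp only [xB]
        clear hx xB
        induction x using TensorProduct.induction_on with
        | zero => simp
        | tmul a b => simp [he]
        | add a b ha hb => simp only [map_add, ha, hb]
      rw [h1, hx]; simp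
    have h2 := LinearMap.congr_fun (dualTensorHom_comp_rTensor_dualMap (P := N) u) xB
    simp only [LinearMap.comp_apply, hxx, map_zero] at h2
    obtain ⟨ψ, hψ⟩ := hN (dualTensorHom R B N xB) h2.symm
    obtain ⟨y, rfl⟩ := (dualTensorHomEquiv R C N).surjective ψ
    refine ⟨TensorProduct.comm R _ _ y, ?_⟩
    have h3 : v.dualMap.rTensor N y = xB := by
      apply (dualTensorHomEquiv R B N).injective
      exact (LinearMap.congr_fun (dualTensorHom_comp_rTensor_dualMap (P := N) v) y).trans hψ
    have h4 : (e1.toLinearMap.lTensor N) ((d2 ∘ₗ w).lTensor N (TensorProduct.comm R _ _ y)) =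
        TensorProduct.comm R _ _ (v.dualMap.rTensor N y) := by
      rw [hw]
      clear hψ h3
      induction y using TensorProduct.induction_on with
      | zero => simp
      | tmul a b => simp
      | add a b ha hb => simp only [map_add, ha, hb]
    apply (LinearEquiv.lTensor N e1).injective
    refine h4.trans ?_
    rw [h3]
    have : ∀ z : N ⊗[R] Module.Dual R B, TensorProduct.comm R _ _ (TensorProduct.comm R _ _ z) = z := by
      intro z; simp
    exact this _
  have hT1 : ∀ x, d1.lTensor N x = 0 → ∃ y, d2.lTensor N y = x := by
    intro x hx
    obtain ⟨y, hy⟩ := key x hx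
    exact ⟨w.lTensor N y, by rw [← hy, LinearMap.lTensor_comp]; rfl⟩
  have hT2 := hrig hT1
  let S : Submodule R P2 := LinearMap.range w ⊔ LinearMap.range d3
  have hS : Subsingleton (P2 ⧸ S) := by
    refine aux_nak (R := R) N _ ?_
    refine subsingleton_of_forall_eq 0 fun q => ?_
    obtain ⟨x, rfl⟩ := LinearMap.lTensor_surjective N S.mkQ_surjective q
    have h0 : d1.lTensor N (d2.lTensor N x) = 0 := by
      rw [← LinearMap.comp_apply, ← LinearMap.lTensor_comp, h12.linearMap_comp_eq_zero]; simp
    obtain ⟨y, hy⟩ := key _ h0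
    have h1 : d2.lTensor N (x - w.lTensor N y) = 0 := by
      rw [map_sub, ← hy, LinearMap.lTensor_comp]; simp
    obtain ⟨z, hz⟩ := hT2 _ h1
    have h2 : x = w.lTensor N y + d3.lTensor N z := by rw [hz]; abel
    have hw0 : S.mkQ ∘ₗ w = 0 := by
      ext c
      simpa using (Submodule.mem_sup_left (LinearMap.mem_range_self w c) : w c ∈ S)
    have hd0 : S.mkQ ∘ₗ d3 = 0 := by
      ext c
      simpa using (Submodule.mem_sup_right (LinearMap.mem_range_self d3 c) : d3 c ∈ S)
    rw [h2, map_add, ← LinearMap.comp_apply, ← LinearMap.comp_apply, ← LinearMap.lTensor_comp,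
      ← LinearMap.lTensor_comp, hw0, hd0]
    simp
  intro φ hφ
  have h5 : d1 (e1.symm φ) = 0 := by
    apply e0.injective
    rw [he, map_zero, LinearEquiv.apply_symm_apply]
    exact hφ
  obtain ⟨p, hp⟩ := (h12 _).1 h5
  have hpS : p ∈ S := by
    rw [← Submodule.Quotient.mk_eq_zero]; exact Subsingleton.elim _ _
  obtain ⟨_, ⟨ψ, rfl⟩, _, ⟨z, rfl⟩, rfl⟩ := Submodule.mem_sup.1 hpS
  refine ⟨ψ, ?_⟩
  have h6 := LinearMap.congr_fun hw ψ
  have h7 := LinearMap.congr_fun h23 z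
  simp only [LinearMap.comp_apply, LinearMap.zero_apply] at h6 h7
  rw [map_add, h6, h7, add_zero] at hp
  exact e1.symm.injective hp

lemma exists_cover_s5 [IsNoetherianRing R] {X0 X1 : ModuleCat.{0} R} (f : X1 ⟶ X0) :
    ∃ (X2 : ModuleCat.{0} R) (d : X2 ⟶ X1), Function.Exact d.hom f.hom ∧ Projective X2 ∧
      (Module.Finite R X1 → Module.Finite R X2) := by
  by_cases h : Module.Finite R X1
  · obtain ⟨n, g, hg⟩ := Module.Finite.exists_fin' R (LinearMap.ker f.hom)
    refine ⟨ModuleCat.of R (Fin n → R), ModuleCat.ofHom ((LinearMap.ker f.hom).subtype ∘ₗ g), ?_,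
      (IsProjective.iff_projective _).1 inferInstance, fun _ => inferInstanceAs (Module.Finite R (Fin n → R))⟩
    intro x
    constructor
    · intro hx
      obtain ⟨y, hy⟩ := hg ⟨x, hx⟩
      exact ⟨y, congrArg Subtype.val hy⟩
    · rintro ⟨y, rfl⟩
      exact (g y).2
  · refine ⟨_, Projective.d f, ?_, inferInstance, fun hc => absurd hc h⟩
    have := exact_d_f f
    rw [ShortComplex.moduleCat_exact_iff_range_eq_ker] at this
    exact LinearMap.exact_iff.2 this.symm

def cover [IsNoetherianRing R] {X0 X1 : ModuleCat.{0} R} (f : X1 ⟶ X0) :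
    Σ' (X2 : ModuleCat.{0} R) (d : X2 ⟶ X1), d ≫ f = 0 :=
  ⟨_, (exists_cover_s5 f).choose_spec.choose, by
    ext x
    exact (exists_cover_s5 f).choose_spec.choose_spec.1.apply_apply_eq_zero x⟩

lemma cover_spec [IsNoetherianRing R] {X0 X1 : ModuleCat.{0} R} (f : X1 ⟶ X0) :
    Function.Exact (cover f).2.1.hom f.hom ∧ Projective (cover f).1 ∧
      (Module.Finite R X1 → Module.Finite R (cover f).1) :=
  (exists_cover_s5 f).choose_spec.choose_spec

lemma exists_res_s5 [IsNoetherianRing R] {X0 X1 Z : ModuleCat.{0} R} (f : X1 ⟶ X0) (p : X0 ⟶ Z)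
    [Projective X0] [Projective X1] (h0 : Module.Finite R X0) (h1 : Module.Finite R X1)
    (hfp : Function.Exact f.hom p.hom) (hp : Function.Surjective p.hom) :
    ∃ (P : ProjectiveResolution Z) (e0 : P.complex.X 0 ≅ X0) (e1 : P.complex.X 1 ≅ X1),
      e1.hom ≫ f = P.complex.d 1 0 ≫ e0.hom ∧ ∀ n, Module.Finite R (P.complex.X n) := by
  let K : ChainComplex (ModuleCat.{0} R) ℕ := ChainComplex.mk' X0 X1 f (fun f => cover f)
  let α : ∀ n, K.X (n + 2) ≅ (cover (K.d (n + 1) n)).1 := 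
    fun n => ChainComplex.mk'XIso X0 X1 f (fun f => cover f) n
  have hα : ∀ n, K.d (n + 2) (n + 1) = (α n).hom ≫ (cover (K.d (n + 1) n)).2.1 :=
    fun n => ChainComplex.mk'_d X0 X1 f (fun f => cover f) n
  have hd : K.d 1 0 = f := ChainComplex.mk'_d_1_0 _ _ _ _
  have hproj : ∀ n, Projective (K.X n) := by
    intro n
    match n with
    | 0 => exact ‹Projective X0›
    | 1 => exact ‹Projective X1›
    | n + 2 =>
      exact Projective.of_iso (α n).symm (cover_spec (K.d (n + 1) n)).2.1
  have hfin : ∀ n, Module.Finite R (K.X n) := by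
    have : ∀ n, Module.Finite R (K.X n) ∧ Module.Finite R (K.X (n + 1)) := by
      intro n
      induction n with
      | zero => exact ⟨h0, h1⟩
      | succ n ih =>
        refine ⟨ih.2, ?_⟩
        have := (cover_spec (K.d (n + 1) n)).2.2 ih.2
        exact Module.Finite.equiv (α n).toLinearEquiv.symm
    exact fun n => (this n).1
  have hex : ∀ n, K.ExactAt (n + 1) := by
    intro n
    rw [HomologicalComplex.exactAt_iff' _ (n + 1 + 1) (n + 1) n (by simp) (by simp)]
    rw [ShortComplex.moduleCat_exact_iff]
    intro x hx
    obtain ⟨y, hy⟩ := ((cover_spec (K.d (n + 1) n)).1 x).1 hx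
    refine ⟨(α n).inv y, ?_⟩
    change K.d (n + 2) (n + 1) ((α n).inv y) = x
    rw [hα]
    simp only [ModuleCat.comp_apply]
    rw [Iso.inv_hom_id_apply]
    exact hy
  have hf0 : K.d 1 0 ≫ p = 0 := by
    rw [hd]; ext x; exact hfp.apply_apply_eq_zero x
  refine ⟨{ complex := K, projective := hproj,
            π := (ChainComplex.toSingle₀Equiv _ _).symm ⟨p, hf0⟩
            quasiIso := ⟨fun n => ?_⟩ }, Iso.refl _, Iso.refl _, ?_, hfin⟩
  · cases n with
    | zero =>
      rw [ChainComplex.quasiIsoAt₀_iff, ShortComplex.quasiIso_iff_of_zeros']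
      · have hE : (ShortComplex.mk (K.d 1 0) p hf0).Exact ∧ Epi p := by
          refine ⟨?_, (ModuleCat.epi_iff_surjective _).2 hp⟩
          rw [ShortComplex.moduleCat_exact_iff]
          intro x hx
          obtain ⟨y, hy⟩ := (hfp x).1 hx
          refine ⟨y, ?_⟩
          change K.d 1 0 y = x
          rw [hd]; exact hy
        refine (ShortComplex.exact_and_epi_g_iff_of_iso ?_).2 hE
        exact ShortComplex.isoMk (Iso.refl _) (Iso.refl _) (Iso.refl _)
          (by simp; rfl) (by
            have hπ := ChainComplex.toSingle₀Equiv_symm_apply_f_zero (C := K) (X := Z) p hf0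
            refine (Category.id_comp p).trans ?_
            refine Eq.trans ?_ (Category.comp_id _).symm
            exact hπ.symm)
      all_goals rfl
    | succ n =>
      rw [quasiIsoAt_iff_exactAt']
      · exact hex n
      · apply ChainComplex.exactAt_succ_single_obj
  · change 𝟙 _ ≫ f = K.d 1 0 ≫ 𝟙 _
    rw [hd]; rfl

lemma aux_ext_iff {M : ModuleCat.{0} R} (P : ProjectiveResolution M) (n : ℕ) (Y : ModuleCat.{0} R) :
    Subsingleton (_root_.ext R n M Y) ↔
      ∀ φ : P.complex.X n →ₗ[R] Y, φ ∘ₗ (P.complex.d (n + 1) n).hom = 0 →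
        ∃ ψ : P.complex.X ((ComplexShape.up ℕ).prev n) →ₗ[R] Y,
          ψ ∘ₗ (P.complex.d n ((ComplexShape.up ℕ).prev n)).hom = φ := by
  rw [← ModuleCat.isZero_iff_subsingleton, (P.isoExt n Y).isZero_iff,
    ← HomologicalComplex.exactAt_iff_isZero_homology,
    HomologicalComplex.exactAt_iff' _ ((ComplexShape.up ℕ).prev n) n (n + 1) rfl (by simp),
    ShortComplex.moduleCat_exact_iff]
  constructor
  · intro H φ hφ
    obtain ⟨ψ, hψ⟩ := H (ModuleCat.ofHom φ) (ModuleCat.hom_ext hφ)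
    exact ⟨ψ.hom, congrArg ModuleCat.Hom.hom hψ⟩
  · intro H φ hφ
    obtain ⟨ψ, hψ⟩ := H (ModuleCat.Hom.hom φ) (congrArg ModuleCat.Hom.hom hφ)
    exact ⟨ModuleCat.ofHom ψ, ModuleCat.hom_ext hψ⟩

lemma tor_iff {T : ModuleCat.{0} R} (P : ProjectiveResolution T) (n : ℕ) (N : ModuleCat.{0} R) :
    Subsingleton (tor R (n + 1) N T) ↔
      ∀ x, (P.complex.d (n + 1) n).hom.lTensor N x = 0 →
        ∃ y, (P.complex.d (n + 2) (n + 1)).hom.lTensor N y = x := by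
  rw [← ModuleCat.isZero_iff_subsingleton]
  refine ((P.isoLeftDerivedObj ((MonoidalCategory.tensoringLeft _).obj N) (n + 1)).isZero_iff).trans ?_
  refine (HomologicalComplex.exactAt_iff_isZero_homology _ _).symm.trans ?_
  rw [HomologicalComplex.exactAt_iff' _ (n + 2) (n + 1) n (by simp) (by simp),
    ShortComplex.moduleCat_exact_iff]
  rfl

end Aux

/-- Auslander: if `N` is Tor-rigid and `Ext^n_R(M,N) = 0`, then
`Ext^n_R(M,R) = 0`. -/
theorem stmt5 [IsNoetherianRing R] [IsLocalRing R]
    (M N : ModuleCat R) [Module.Finite R M] [Module.Finite R N]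
    (hM : Nontrivial M) (hN : Nontrivial N) (hrig : TorRigid R N)
    (n : ℕ) (h : Subsingleton (ext R n M N)) :
    Subsingleton (ext R n M (ModuleCat.of R R)) := by
  obtain ⟨X0, p, hp, hX0, hX0f⟩ := exists_cover_s5 (0 : M ⟶ M)
  obtain ⟨X1, f, hf, hX1, hX1f⟩ := exists_cover_s5 p
  have hfin0 := hX0f inferInstance
  have hfin1 := hX1f hfin0
  obtain ⟨F, -, -, -, hF⟩ := exists_res_s5 f p hfin0 hfin1 hf (fun x => (hp x).1 rfl)
  have hFp : ∀ n, Module.Projective R (F.complex.X n) := fun n =>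
    have := F.projective n
    (F.complex.X n).projective_of_module_projective
  rw [aux_ext_iff F] at h ⊢
  let u := (F.complex.d (n + 1) n).hom
  let T : ModuleCat R := ModuleCat.of R (Module.Dual R (F.complex.X (n + 1)) ⧸ LinearMap.range u.dualMap)
  have : Projective (ModuleCat.of R (Module.Dual R (F.complex.X n))) :=
    (IsProjective.iff_projective _).1 inferInstance
  have : Projective (ModuleCat.of R (Module.Dual R (F.complex.X (n + 1)))) :=
    (IsProjective.iff_projective _).1 inferInstance
  obtain ⟨P, e0, e1, he, hP⟩ := exists_res_s5 (Z := T) (ModuleCat.ofHom u.dualMap)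
    (ModuleCat.ofHom (LinearMap.range u.dualMap).mkQ)
    (inferInstanceAs (Module.Finite R (Module.Dual R (F.complex.X (n + 1)))))
    (inferInstanceAs (Module.Finite R (Module.Dual R (F.complex.X n))))
    (LinearMap.exact_map_mkQ_range _) (Submodule.mkQ_surjective _)
  have hT : Module.Finite R T :=
    inferInstanceAs (Module.Finite R (Module.Dual R (F.complex.X (n + 1)) ⧸ LinearMap.range u.dualMap))
  have hr := hrig T hT 1 le_rfl
  rw [tor_iff P, tor_iff P] at hr
  refine aux_core (N := N) u (F.complex.d n ((ComplexShape.up ℕ).prev n)).hom ?_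
    (P.complex.d 1 0).hom (P.complex.d 2 1).hom (P.complex.d 3 2).hom
    e0.toLinearEquiv e1.toLinearEquiv ?_ ?_ ?_ h hr
  · exact congrArg ModuleCat.Hom.hom (F.complex.d_comp_d _ _ _)
  · intro x
    exact (LinearMap.congr_fun (congrArg ModuleCat.Hom.hom he) x).symm
  · have := P.exact_succ 0
    rw [ShortComplex.moduleCat_exact_iff_range_eq_ker] at this
    exact LinearMap.exact_iff.2 this.symm
  · exact congrArg ModuleCat.Hom.hom (P.complex.d_comp_d _ _ _)
end
end
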